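/- arXiv:2011.01171 — 2 statements merged into one kernel-verified Lean document; each statement's English description precedes it below -/
import Mathlib

section
/- With A, B and ℓ as defined, a vector r ∈ ℚ¹⁴ lies in the range of the linear map Bᵀ : ℚ⁷ → ℚ¹⁴ if and only if A·r = 0 and ℓ(r) = 0. -/
/-- The second Feynman transform differential (edge degree 1 → 2) of the S₄-coinvariants
of the internal-degree-(-4) summand of FT(H_*(M̄))(1,4), in the basis λ₁,…,λ₁₄. -/
def A : Matrix (Fin 6) (Fin 14) ℚ :=
  !![0, 0, 0, 0, 0, 1, 0, 0, -1, 0, 0, 0, 0, 0;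
     1, 0, 0, 0, -1, 0, 0, 0, 0, 0, 0, 0, 0, 0;
     0, 1, 0, 0, 0, 0, -1, 0, 0, 0, 0, 0, 0, 0;
     0, 0, -1, 0, 0, 0, 0, 0, 0, 0, 1, 0, 0, 0;
     0, 0, 0, -1, 0, 0, 0, 0, 0, 0, 0, 1, 0, 0;
     0, 0, 0, 0, 0, 0, 0, -1, 0, 0, 0, 0, 1, 0]

/-- The transpose of the first Feynman transform differential (edge degree 0 → 1). -/
def B : Matrix (Fin 7) (Fin 14) ℚ :=
  !![0, 0, 0, 0, 0, 0, 0, 0, 0, 2, 0, 0, 0, 6;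
     0, 0, 0, 0, 0, 1, 0, 0, 1, 0, 0, 0, 0, -2;
     1, 0, 0, 0, 1, 0, 0, 0, 0, 0, 0, 0, 0, 3;
     0, 1, 0, 0, 0, 0, 1, 0, 0, 0, 0, 0, 0, -1;
     0, 0, 1, 0, 0, 0, 0, 0, 0, 0, 1, 0, 0, 1/2;
     0, 0, 0, 1, 0, 0, 0, 0, 0, 0, 0, 1, 0, 1/2;
     0, 0, 0, 0, 0, 0, 0, 1, 0, 0, 0, 0, 1, 0]

/-- The linear functional `|·|/e` of Lemma 4.4. -/
def ell (r : Fin 14 → ℚ) : ℚ :=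
  -6 * r 0 + 2 * r 1 - r 2 - r 3 + 4 * r 5 - 6 * r 9 + 2 * r 13

/-- The coefficients `tᵢ` defining the map `f̄^ω : λᵢ ↦ tᵢ ω`. -/
def t (e : ℚ) : Fin 14 → ℚ :=
  ![-3 * e, e, -e / 2, -e / 2, -3 * e, 2 * e, e, 0, 2 * e, -6 * e, -e / 2, -e / 2, 0, 2 * e]

/-- Lemma 4.4(2): r is a boundary iff r is a cycle with vanishing functional. -/
theorem stmt_8 :
    ∀ r : Fin 14 → ℚ,
      r ∈ LinearMap.range (Matrix.mulVecLin B.transpose) ↔ (A.mulVec r = 0 ∧ ell r = 0) := by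
  intro r
  constructor
  · rintro ⟨x, rfl⟩
    constructor
    · ext i
      fin_cases i <;>
        simp [A, B, Matrix.mulVec, dotProduct, Fin.sum_univ_succ, Matrix.transpose_apply]
    · simp [ell, B, Matrix.mulVec, dotProduct, Fin.sum_univ_succ, Matrix.transpose_apply]
      ring
  · rintro ⟨h, hl⟩
    have h0 := congrFun h 0
    have h1 := congrFun h 1
    have h2 := congrFun h 2
    have h3 := congrFun h 3
    have h4 := congrFun h 4
    have h5 := congrFun h 5
    simp [A, Matrix.mulVec, dotProduct, Fin.sum_univ_succ] at h0 h1 h2 h3 h4 h5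
    simp only [ell] at hl
    refine ⟨![r 9 / 2, r 5, r 0, r 1, r 2, r 3, r 7], ?_⟩
    ext i
    fin_cases i <;>
      simp [B, Matrix.mulVec, dotProduct, Fin.sum_univ_succ, Matrix.transpose_apply] <;>
      simp [Fin.succ] at * <;> linarith
end

section
/- With A, B and ℓ as defined, the range of Bᵀ : ℚ⁷ → ℚ¹⁴ is contained in the kernel of A : ℚ¹⁴ → ℚ⁶, the quotient ℚ-vector space ker(A)/range(Bᵀ) is one-dimensional, and the linear functional ℓ vanishes on range(Bᵀ) and induces a ℚ-linear isomorphism ker(A)/range(Bᵀ) ≅ ℚ. -/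
theorem mem_kerA (r : Fin 14 → ℚ) : r ∈ LinearMap.ker (Matrix.mulVecLin A) ↔
    (r 5 = r 8 ∧ r 0 = r 4 ∧ r 1 = r 6 ∧ r 2 = r 10 ∧ r 3 = r 11 ∧ r 7 = r 12) := by
  rw [LinearMap.mem_ker, Matrix.mulVecLin_apply, funext_iff]
  simp only [Fin.forall_fin_succ, Matrix.mulVec, dotProduct, Fin.sum_univ_succ, A]
  simp
  constructor
  · rintro ⟨h1, h2, h3, h4, h5, h6⟩
    refine ⟨?_, ?_, ?_, ?_, ?_, ?_⟩ <;> linarith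
  · rintro ⟨h1, h2, h3, h4, h5, h6⟩
    refine ⟨?_, ?_, ?_, ?_, ?_, ?_⟩ <;> linarith

theorem mulB (y : Fin 7 → ℚ) : Matrix.mulVecLin B.transpose y =
    ![y 2, y 3, y 4, y 5, y 2, y 1, y 3, y 6, y 1, 2 * y 0, y 4, y 5, y 6,
      6 * y 0 - 2 * y 1 + 3 * y 2 - y 3 + y 4 / 2 + y 5 / 2] := by
  rw [Matrix.mulVecLin_apply]
  ext i
  fin_cases i <;>
    simp [Matrix.mulVec, dotProduct, Fin.sum_univ_succ, B, Fin.succ] <;> ring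

theorem rangeB_le :
    LinearMap.range (Matrix.mulVecLin B.transpose) ≤ LinearMap.ker (Matrix.mulVecLin A) := by
  rintro _ ⟨y, rfl⟩
  rw [mem_kerA, mulB]
  exact ⟨rfl, rfl, rfl, rfl, rfl, rfl⟩

theorem ell_rangeB (r : Fin 14 → ℚ) (hr : r ∈ LinearMap.range (Matrix.mulVecLin B.transpose)) :
    ell r = 0 := by
  obtain ⟨y, rfl⟩ := hr
  rw [mulB]
  simp [ell]
  ring

theorem mem_rangeB (r : Fin 14 → ℚ) (hA : r ∈ LinearMap.ker (Matrix.mulVecLin A))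
    (h : ell r = 0) : r ∈ LinearMap.range (Matrix.mulVecLin B.transpose) := by
  rw [mem_kerA] at hA
  obtain ⟨h1, h2, h3, h4, h5, h6⟩ := hA
  refine ⟨![r 9 / 2, r 5, r 0, r 1, r 2, r 3, r 7], ?_⟩
  rw [mulB]
  unfold ell at h
  ext i
  fin_cases i <;> simp <;> linarith

/-- `ell` as a linear map. -/
def ellLin : (Fin 14 → ℚ) →ₗ[ℚ] ℚ where
  toFun := ell
  map_add' x y := by simp only [ell, Pi.add_apply]; ring
  map_smul' c x := by simp only [ell, Pi.smul_apply, smul_eq_mul, RingHom.id_apply]; ring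

theorem exists_equiv : ∃ φ : ((LinearMap.ker (Matrix.mulVecLin A)) ⧸
        (LinearMap.range (Matrix.mulVecLin B.transpose)).comap
          (LinearMap.ker (Matrix.mulVecLin A)).subtype) ≃ₗ[ℚ] ℚ,
      ∀ x : LinearMap.ker (Matrix.mulVecLin A),
        φ (Submodule.Quotient.mk x) = ell (x : Fin 14 → ℚ) := by
  let f := ellLin.comp (LinearMap.ker (Matrix.mulVecLin A)).subtype
  have hk : (LinearMap.range (Matrix.mulVecLin B.transpose)).comap
      (LinearMap.ker (Matrix.mulVecLin A)).subtype = LinearMap.ker f := by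
    ext x
    exact ⟨fun h => ell_rangeB _ h, fun h => mem_rangeB _ x.2 h⟩
  have hs : Function.Surjective f := by
    intro c
    refine ⟨⟨Pi.single 13 (c / 2), ?_⟩, ?_⟩
    · rw [mem_kerA]
      simp [Pi.single_apply]
    · change ell (Pi.single 13 (c / 2)) = c
      simp [ell, Pi.single_apply]
      ring
  exact ⟨(Submodule.quotEquivOfEq _ _ hk).trans (f.quotKerEquivOfSurjective hs), fun x => rfl⟩

/-- the weight-4 homology in edge degree 1 is one-dimensional, detected by
the functional: range(Bᵀ) ⊆ ker(A), dim ker(A)/range(Bᵀ) = 1, the functional vanishes on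
range(Bᵀ), and it induces a linear isomorphism ker(A)/range(Bᵀ) ≅ ℚ. -/
theorem stmt_10 :
    LinearMap.range (Matrix.mulVecLin B.transpose) ≤ LinearMap.ker (Matrix.mulVecLin A) ∧
    Module.finrank ℚ
      ((LinearMap.ker (Matrix.mulVecLin A)) ⧸
        (LinearMap.range (Matrix.mulVecLin B.transpose)).comap
          (LinearMap.ker (Matrix.mulVecLin A)).subtype) = 1 ∧
    (∀ r ∈ LinearMap.range (Matrix.mulVecLin B.transpose), ell r = 0) ∧
    ∃ φ : ((LinearMap.ker (Matrix.mulVecLin A)) ⧸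
        (LinearMap.range (Matrix.mulVecLin B.transpose)).comap
          (LinearMap.ker (Matrix.mulVecLin A)).subtype) ≃ₗ[ℚ] ℚ,
      ∀ x : LinearMap.ker (Matrix.mulVecLin A),
        φ (Submodule.Quotient.mk x) = ell (x : Fin 14 → ℚ) := by
  obtain ⟨φ, hφ⟩ := exists_equiv
  exact ⟨rangeB_le, by rw [φ.finrank_eq, Module.finrank_self], ell_rangeB, φ, hφ⟩
end
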